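/- Every infinite group Γ with a finite symmetric generating set, equipped with the word metric, satisfies the linear isoperimetric-type inequality: there exists C > 0 such that #A ≤ C·∑_{x∈∂A} (1 + |x|) for every finite subset A ⊆ Γ. -/

import Mathlib

/-- Word length of `γ` with respect to a generating set `S`. -/
noncomputable def wLen {Γ : Type*} [Group Γ] (S : Set Γ) (γ : Γ) : ℕ :=
  sInf {n | ∃ l : List Γ, (∀ s ∈ l, s ∈ S) ∧ l.length = n ∧ l.prod = γ}

/-- The left-invariant word metric `d(x,y) = |x⁻¹y|`. -/
noncomputable def wDist {Γ : Type*} [Group Γ] (S : Set Γ) (x y : Γ) : ℕ :=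
  wLen S (x⁻¹ * y)

/-- The boundary `∂A` with respect to the word metric of `S`. -/
def isoBdryW {Γ : Type*} [Group Γ] (S : Set Γ) (A : Set Γ) : Set Γ :=
  {x | (∃ a ∈ A, wDist S x a ≤ 1) ∧ (∃ b ∈ Aᶜ, wDist S x b ≤ 1)}

/-- The isoperimetric inequality `(I^f_∂)` for the word metric of `S`. -/
def SatIsoW {Γ : Type*} [Group Γ] (S : Set Γ) (f : ℝ → ℝ) : Prop :=
  ∃ C > (0:ℝ), ∀ A : Finset Γ,
    (A.card : ℝ) ≤ C * ∑ᶠ x ∈ isoBdryW S (A : Set Γ), f (wLen S x : ℝ)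

theorem wLen_le_length {Γ : Type*} [Group Γ] {S : Set Γ} {l : List Γ} (hl : ∀ s ∈ l, s ∈ S) :
    wLen S l.prod ≤ l.length :=
  Nat.sInf_le ⟨l, hl, rfl, rfl⟩

theorem exists_list_length_eq_wLen {Γ : Type*} [Group Γ] {S : Set Γ}
    (hsym : ∀ s ∈ S, s⁻¹ ∈ S) (hgen : Subgroup.closure S = ⊤) (γ : Γ) :
    ∃ l : List Γ, (∀ s ∈ l, s ∈ S) ∧ l.length = wLen S γ ∧ l.prod = γ := by
  have hne : {n | ∃ l : List Γ, (∀ s ∈ l, s ∈ S) ∧ l.length = n ∧ l.prod = γ}.Nonempty := by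
    have hγ : γ ∈ (Subgroup.closure S).toSubmonoid := by simp [hgen]
    rw [Subgroup.closure_toSubmonoid] at hγ
    obtain ⟨l, hl, hprod⟩ := Submonoid.exists_list_of_mem_closure hγ
    refine ⟨l.length, l, fun s hs => ?_, rfl, hprod⟩
    rcases hl s hs with h | h
    · exact h
    · simpa using hsym _ h
  exact Nat.sInf_mem hne

theorem wLen_one {Γ : Type*} [Group Γ] (S : Set Γ) : wLen S 1 = 0 := by
  simpa using wLen_le_length (S := S) (l := []) (by simp)

theorem wLen_le_one {Γ : Type*} [Group Γ] {S : Set Γ} {s : Γ} (hs : s ∈ S) : wLen S s ≤ 1 := by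
  simpa using wLen_le_length (S := S) (l := [s]) (by simpa using hs)

theorem wLen_mul_le {Γ : Type*} [Group Γ] {S : Set Γ}
    (hsym : ∀ s ∈ S, s⁻¹ ∈ S) (hgen : Subgroup.closure S = ⊤) (a b : Γ) :
    wLen S (a * b) ≤ wLen S a + wLen S b := by
  obtain ⟨l, hl, hlen, rfl⟩ := exists_list_length_eq_wLen hsym hgen a
  obtain ⟨m, hm, hmlen, rfl⟩ := exists_list_length_eq_wLen hsym hgen b
  rw [← hlen, ← hmlen, ← List.prod_append, ← List.length_append]
  refine wLen_le_length fun s hs => ?_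
  rcases List.mem_append.1 hs with h | h
  exacts [hl s h, hm s h]

theorem wLen_inv_le {Γ : Type*} [Group Γ] {S : Set Γ}
    (hsym : ∀ s ∈ S, s⁻¹ ∈ S) (hgen : Subgroup.closure S = ⊤) (a : Γ) :
    wLen S a⁻¹ ≤ wLen S a := by
  obtain ⟨l, hl, hlen, rfl⟩ := exists_list_length_eq_wLen hsym hgen a
  rw [← hlen, List.prod_inv_reverse]
  refine (wLen_le_length fun s hs => ?_).trans (by simp)
  obtain ⟨t, ht, rfl⟩ := List.mem_map.1 (List.mem_reverse.1 hs)
  exact hsym _ (hl t ht)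

theorem finite_setOf_wLen_le {Γ : Type*} [Group Γ] (S : Finset Γ)
    (hsym : ∀ s ∈ S, s⁻¹ ∈ S) (hgen : Subgroup.closure (S : Set Γ) = ⊤) (n : ℕ) :
    {γ | wLen (S : Set Γ) γ ≤ n}.Finite := by
  refine ((List.finite_length_le S n).image
    fun l => (l.map (Subtype.val : S → Γ)).prod).subset fun γ hγ => ?_
  obtain ⟨l, hl, hlen, rfl⟩ := exists_list_length_eq_wLen (S := (S : Set Γ)) hsym hgen γ
  lift l to List S using hl
  refine ⟨l, ?_, rfl⟩
  rw [List.length_map] at hlen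
  exact hlen.trans_le hγ

/-- An infinite finitely generated group contains geodesic segments of every length. -/
theorem exists_geodesic {Γ : Type*} [Group Γ] [Infinite Γ] (S : Finset Γ)
    (hsym : ∀ s ∈ S, s⁻¹ ∈ S) (hgen : Subgroup.closure (S : Set Γ) = ⊤) (n : ℕ) :
    ∃ h : ℕ → Γ, (∀ i < n, (h i)⁻¹ * h (i + 1) ∈ S) ∧
      ∀ i j, i ≤ j → j ≤ n → j - i ≤ wLen (S : Set Γ) ((h i)⁻¹ * h j) := by
  obtain ⟨γ, hγ⟩ := (finite_setOf_wLen_le S hsym hgen n).exists_notMem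
  replace hγ : n < wLen (S : Set Γ) γ := not_le.1 hγ
  obtain ⟨l, hl, hlen, hprod⟩ := exists_list_length_eq_wLen (S := (S : Set Γ)) hsym hgen γ
  refine ⟨fun i => (l.take i).prod, fun i hi => ?_, fun i j hij hj => ?_⟩
  · beta_reduce
    rw [List.prod_take_succ l i (by omega), inv_mul_cancel_left]
    exact hl _ (List.getElem_mem _)
  · have hγ' : γ = (l.take i).prod * (((l.take i).prod⁻¹ * (l.take j).prod) *
        (l.drop j).prod) := by
      rw [mul_assoc, mul_inv_cancel_left, List.prod_take_mul_prod_drop, hprod]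
    have h1 := wLen_mul_le (S := (S : Set Γ)) hsym hgen (l.take i).prod
      (((l.take i).prod⁻¹ * (l.take j).prod) * (l.drop j).prod)
    have h2 := wLen_mul_le (S := (S : Set Γ)) hsym hgen
      ((l.take i).prod⁻¹ * (l.take j).prod) (l.drop j).prod
    have h3 := wLen_le_length (S := (S : Set Γ)) (l := l.take i)
      fun s hs => hl s (List.mem_of_mem_take hs)
    have h4 := wLen_le_length (S := (S : Set Γ)) (l := l.drop j)
      fun s hs => hl s (List.mem_of_mem_drop hs)
    rw [← hγ'] at h1
    rw [List.length_take] at h3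
    rw [List.length_drop] at h4
    change j - i ≤ wLen (S : Set Γ) ((l.take i).prod⁻¹ * (l.take j).prod)
    omega

theorem finite_isoBdryW {Γ : Type*} [Group Γ] (S : Finset Γ)
    (hsym : ∀ s ∈ S, s⁻¹ ∈ S) (hgen : Subgroup.closure (S : Set Γ) = ⊤) (A : Finset Γ) :
    (isoBdryW (S : Set Γ) (A : Set Γ)).Finite := by
  refine (A.finite_toSet.image2 (fun a b => a * b⁻¹)
    (finite_setOf_wLen_le S hsym hgen 1)).subset ?_
  rintro x ⟨⟨a, ha, hxa⟩, -⟩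
  exact ⟨a, ha, x⁻¹ * a, hxa, by simp⟩

/-- A path that is injective for longer than the cardinality of `A` must leave `A`. -/
theorem Finset.exists_mem_and_succ_notMem {α : Type*} (A : Finset α) {n : ℕ} (hn : A.card ≤ n)
    (q : ℕ → α) (hinj : Set.InjOn q (Set.Iic n)) (h0 : q 0 ∈ A) :
    ∃ k < n, q k ∈ A ∧ q (k + 1) ∉ A := by
  by_contra! hcon
  have hmem : ∀ k ≤ n, q k ∈ A := by
    intro k
    induction k with
    | zero => exact fun _ => h0
    | succ k ih => exact fun hk => hcon k hk (ih (by omega))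
  have hcard := Finset.card_le_card_of_injOn (s := Finset.range (n + 1)) (t := A) q
    (fun k hk => hmem k (by simpa [Nat.lt_succ_iff] using hk))
    (hinj.mono fun k hk => by simpa [Nat.lt_succ_iff] using hk)
  rw [Finset.card_range] at hcard
  omega

theorem mem_isoBdryW {Γ : Type*} [Group Γ] {S A : Set Γ} {a b : Γ} (ha : a ∈ A) (hb : b ∉ A)
    (h : b⁻¹ * a ∈ S) : b ∈ isoBdryW S A :=
  ⟨⟨a, ha, wLen_le_one h⟩, ⟨b, hb, by simp [wDist, wLen_one]⟩⟩

/-- If `h` is a geodesic of length `2 * N` with `A.card ≤ N`, then its translate centred at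
`x ∈ A` meets the boundary of `A` at a point at least as far from `1` as from `x`. -/
theorem exists_mem_isoBdryW_of_geodesic {Γ : Type*} [Group Γ] (S : Finset Γ)
    (hsym : ∀ s ∈ S, s⁻¹ ∈ S) (hgen : Subgroup.closure (S : Set Γ) = ⊤) (A : Finset Γ) {N : ℕ}
    (hN : A.card ≤ N) {h : ℕ → Γ} (hstep : ∀ i < 2 * N, (h i)⁻¹ * h (i + 1) ∈ S)
    (hgeo : ∀ i j, i ≤ j → j ≤ 2 * N → j - i ≤ wLen (S : Set Γ) ((h i)⁻¹ * h j))
    {x : Γ} (hx : x ∈ A) :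
    ∃ i, x * (h N)⁻¹ * h i ∈ isoBdryW (S : Set Γ) (A : Set Γ) ∧
      N ≤ i + wLen (S : Set Γ) (x * (h N)⁻¹ * h i) ∧
      i ≤ N + wLen (S : Set Γ) (x * (h N)⁻¹ * h i) := by
  have hinj : Set.InjOn h (Set.Iic (2 * N)) := by
    have aux : ∀ i j, i < j → j ≤ 2 * N → h i ≠ h j := fun i j hij hj heq => by
      have := hgeo i j hij.le hj
      rw [heq, inv_mul_cancel, wLen_one] at this
      omega
    intro i hi j hj heq
    rcases lt_trichotomy i j with hij | hij | hij
    · exact absurd heq (aux i j hij hj)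
    · exact hij
    · exact absurd heq.symm (aux j i hij hi)
  by_cases hfwd : ∀ k ≤ N, k ≤ wLen (S : Set Γ) (x * (h N)⁻¹ * h (N + k))
  · obtain ⟨k, hk, hin, hout⟩ := A.exists_mem_and_succ_notMem hN
      (fun k => x * (h N)⁻¹ * h (N + k))
      (fun i hi j hj heq => by
        simp only [Set.mem_Iic] at hi hj
        have := hinj (x₁ := N + i) (x₂ := N + j) (by simp; omega) (by simp; omega)
          (mul_left_cancel heq)
        omega)
      (by simpa using hx)
    refine ⟨N + (k + 1), mem_isoBdryW hin hout ?_, ?_, ?_⟩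
    · have := hsym _ (hstep (N + k) (by omega))
      simpa [mul_assoc, add_assoc] using this
    · omega
    · have := hfwd (k + 1) hk
      omega
  · push Not at hfwd
    obtain ⟨n, hn, hlt⟩ := hfwd
    have hbwd : ∀ k ≤ N, k ≤ wLen (S : Set Γ) (x * (h N)⁻¹ * h (N - k)) := by
      intro k hk
      have h1 := hgeo (N - k) (N + n) (by omega) (by omega)
      have h2 := wLen_mul_le (S := (S : Set Γ)) hsym hgen (x * (h N)⁻¹ * h (N - k))⁻¹
        (x * (h N)⁻¹ * h (N + n))
      have h3 := wLen_inv_le (S := (S : Set Γ)) hsym hgen (x * (h N)⁻¹ * h (N - k))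
      have h4 : (x * (h N)⁻¹ * h (N - k))⁻¹ * (x * (h N)⁻¹ * h (N + n)) =
          (h (N - k))⁻¹ * h (N + n) := by group
      rw [h4] at h2
      omega
    obtain ⟨k, hk, hin, hout⟩ := A.exists_mem_and_succ_notMem hN
      (fun k => x * (h N)⁻¹ * h (N - k))
      (fun i hi j hj heq => by
        simp only [Set.mem_Iic] at hi hj
        have := hinj (x₁ := N - i) (x₂ := N - j) (by simp; omega) (by simp; omega)
          (mul_left_cancel heq)
        omega)
      (by simpa using hx)
    refine ⟨N - (k + 1), mem_isoBdryW hin hout ?_, ?_, ?_⟩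
    · have := hstep (N - (k + 1)) (by omega)
      rw [show N - (k + 1) + 1 = N - k by omega] at this
      simpa [mul_assoc] using this
    · have := hbwd (k + 1) hk
      omega
    · omega

/-- Every infinite finitely generated group satisfies the linear
isoperimetric-type inequality `#A ≤ C · ∑_{x ∈ ∂A} (1 + |x|)`. -/
theorem linear_isoperimetric_inequality_on_groups
    {Γ : Type*} [Group Γ] [Infinite Γ] (S : Finset Γ)
    (hsym : ∀ s ∈ S, s⁻¹ ∈ S)
    (hgen : Subgroup.closure (S : Set Γ) = ⊤) :
    ∃ C > (0:ℝ), ∀ A : Finset Γ,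
      (A.card : ℝ) ≤
        C * ∑ᶠ x ∈ isoBdryW (S : Set Γ) (A : Set Γ),
          (1 + (wLen (S : Set Γ) x : ℝ)) := by
  classical
  refine ⟨2, two_pos, fun A => ?_⟩
  have hfin := finite_isoBdryW S hsym hgen A
  obtain ⟨h, hstep, hgeo⟩ := exists_geodesic S hsym hgen (2 * A.card)
  set N := A.card with hN
  let T := hfin.toFinset.sigma fun b =>
    Finset.Icc (N - wLen (S : Set Γ) b) (N + wLen (S : Set Γ) b)
  have hsub : A ⊆ T.image fun p => p.1 * (h p.2)⁻¹ * h N := by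
    intro x hx
    obtain ⟨i, hmem, hlo, hhi⟩ :=
      exists_mem_isoBdryW_of_geodesic S hsym hgen A hN.ge hstep hgeo hx
    refine Finset.mem_image.2 ⟨⟨x * (h N)⁻¹ * h i, i⟩, ?_, by simp⟩
    exact Finset.mem_sigma.2 ⟨hfin.mem_toFinset.2 hmem,
      Finset.mem_Icc.2 ⟨Nat.sub_le_iff_le_add.2 hlo, hhi⟩⟩
  have hcard : N ≤ ∑ b ∈ hfin.toFinset, 2 * (1 + wLen (S : Set Γ) b) := by
    refine (Finset.card_le_card hsub).trans (Finset.card_image_le.trans ?_)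
    rw [Finset.card_sigma]
    refine Finset.sum_le_sum fun b _ => ?_
    rw [Nat.card_Icc]
    omega
  rw [finsum_mem_eq_finite_toFinset_sum _ hfin, Finset.mul_sum]
  exact_mod_cast hcard
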